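/- arXiv:1010.3126 — 2 statements merged into one kernel-verified Lean document; each statement's English description precedes it below -/
import Mathlib

section
/- Let r, b, c, r₁, a₁₀, a₀₁, a₀₀ : ℝ² → ℝ be smooth, and consider the operators L₂ : u ↦ ∂ₓ∂ₓu + b·∂_yu + c·u (type (X²) with zero coefficient at Dₓ), L₁ : v ↦ ∂ₓv + r·v, F₁ : u ↦ r₁·u, F₂ : u ↦ a₁₀·∂ₓu + a₀₁·∂_yu + a₀₀·u. Then the linearized factorization equation F₁(L₂u) + L₁(F₂u) = 0 holds for every smooth u : ℝ² → ℝ if and only if a₀₁ = 0, r₁ = −a₁₀, a₁₀·b = 0, a₀₀ = −r·a₁₀ − ∂ₓa₁₀, and c·a₁₀ + r²·a₁₀ + 2r·∂ₓa₁₀ + a₁₀·∂ₓr + ∂ₓ∂ₓa₁₀ = 0 on ℝ². In particular a nontrivial solution exists only where b = 0, i.e., only if the operator is almost ordinary. -/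
/-- Partial derivative in the first (`x`) variable of a function on the plane. -/
noncomputable def Dx (u : ℝ → ℝ → ℝ) : ℝ → ℝ → ℝ := fun x y => deriv (fun s => u s y) x

/-- Partial derivative in the second (`y`) variable of a function on the plane. -/
noncomputable def Dy (u : ℝ → ℝ → ℝ) : ℝ → ℝ → ℝ := fun x y => deriv (fun t => u x t) y

/-- A function on the plane is smooth if it is infinitely differentiable as a function
of the pair of variables. -/
def Smooth2 (u : ℝ → ℝ → ℝ) : Prop := ContDiff ℝ (⊤ : ℕ∞) (fun p : ℝ × ℝ => u p.1 p.2)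

/-- The first-order operator `Dₓ + p`, sending `u` to `∂ₓu + p·u`. -/
noncomputable def opX (p u : ℝ → ℝ → ℝ) : ℝ → ℝ → ℝ := fun x y => Dx u x y + p x y * u x y

/-- The first-order operator `D_y + q`, sending `u` to `∂_yu + q·u`. -/
noncomputable def opY (q u : ℝ → ℝ → ℝ) : ℝ → ℝ → ℝ := fun x y => Dy u x y + q x y * u x y

theorem Smooth2.hasDerivAt_fst {u : ℝ → ℝ → ℝ} (hu : Smooth2 u) (x y : ℝ) :
    HasDerivAt (fun s => u s y) (fderiv ℝ (fun p : ℝ × ℝ => u p.1 p.2) (x, y) (1, 0)) x := by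
  have h : HasFDerivAt (fun p : ℝ × ℝ => u p.1 p.2) _ (x, y) :=
    (ContDiff.differentiable hu (by simp) (x, y)).hasFDerivAt
  exact h.comp_hasDerivAt x ((hasDerivAt_id x).prodMk (hasDerivAt_const x y))

theorem Smooth2.hasDerivAt_snd {u : ℝ → ℝ → ℝ} (hu : Smooth2 u) (x y : ℝ) :
    HasDerivAt (fun t => u x t) (fderiv ℝ (fun p : ℝ × ℝ => u p.1 p.2) (x, y) (0, 1)) y := by
  have h : HasFDerivAt (fun p : ℝ × ℝ => u p.1 p.2) _ (x, y) :=
    (ContDiff.differentiable hu (by simp) (x, y)).hasFDerivAt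
  exact h.comp_hasDerivAt y ((hasDerivAt_const y x).prodMk (hasDerivAt_id y))

theorem Smooth2.hasDerivAt_Dx {u : ℝ → ℝ → ℝ} (hu : Smooth2 u) (x y : ℝ) :
    HasDerivAt (fun s => u s y) (Dx u x y) x :=
  (hu.hasDerivAt_fst x y).differentiableAt.hasDerivAt

theorem Smooth2.dx {u : ℝ → ℝ → ℝ} (hu : Smooth2 u) : Smooth2 (Dx u) := by
  have h : (fun p : ℝ × ℝ => Dx u p.1 p.2) =
      fun p => fderiv ℝ (fun p : ℝ × ℝ => u p.1 p.2) p (1, 0) :=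
    funext fun p => (hu.hasDerivAt_fst p.1 p.2).deriv
  rw [Smooth2, h]
  exact (ContDiff.fderiv_right hu (by simp)).clm_apply contDiff_const

theorem Smooth2.dy {u : ℝ → ℝ → ℝ} (hu : Smooth2 u) : Smooth2 (Dy u) := by
  have h : (fun p : ℝ × ℝ => Dy u p.1 p.2) =
      fun p => fderiv ℝ (fun p : ℝ × ℝ => u p.1 p.2) p (0, 1) :=
    funext fun p => (hu.hasDerivAt_snd p.1 p.2).deriv
  rw [Smooth2, h]
  exact (ContDiff.fderiv_right hu (by simp)).clm_apply contDiff_const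

/-- The linearized factorization operator, collected by the partial derivatives of `u`. -/
theorem linearized_factorization_expand {a₁₀ a₀₁ a₀₀ u : ℝ → ℝ → ℝ} (r b c r₁ : ℝ → ℝ → ℝ)
    (ha₁₀ : Smooth2 a₁₀) (ha₀₁ : Smooth2 a₀₁) (ha₀₀ : Smooth2 a₀₀) (hu : Smooth2 u) (x y : ℝ) :
    r₁ x y * (Dx (Dx u) x y + b x y * Dy u x y + c x y * u x y)
        + opX r (fun x y => a₁₀ x y * Dx u x y + a₀₁ x y * Dy u x y + a₀₀ x y * u x y) x y
      = (r₁ x y + a₁₀ x y) * Dx (Dx u) x y + a₀₁ x y * Dx (Dy u) x y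
        + (Dx a₁₀ x y + a₀₀ x y + r x y * a₁₀ x y) * Dx u x y
        + (r₁ x y * b x y + Dx a₀₁ x y + r x y * a₀₁ x y) * Dy u x y
        + (r₁ x y * c x y + Dx a₀₀ x y + r x y * a₀₀ x y) * u x y := by
  have h : Dx (fun x y => a₁₀ x y * Dx u x y + a₀₁ x y * Dy u x y + a₀₀ x y * u x y) x y = _ :=
    ((((ha₁₀.hasDerivAt_Dx x y).mul (hu.dx.hasDerivAt_Dx x y)).add
      ((ha₀₁.hasDerivAt_Dx x y).mul (hu.dy.hasDerivAt_Dx x y))).add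
      ((ha₀₀.hasDerivAt_Dx x y).mul (hu.hasDerivAt_Dx x y))).deriv
  rw [opX, h]
  ring

theorem Dx_eq_zero_of_forall {u : ℝ → ℝ → ℝ} (h : ∀ x y, u x y = 0) (x y : ℝ) :
    Dx u x y = 0 := by
  simp [Dx, h]

/-- A second-order expression in `∂ₓ∂ₓ, ∂ₓ∂_y, ∂ₓ, ∂_y, 1` that vanishes at a point on all smooth
functions has vanishing coefficients. -/
theorem coeffs_eq_zero_of_forall_smooth {x y A B C D E : ℝ}
    (h : ∀ u : ℝ → ℝ → ℝ, Smooth2 u →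
      A * Dx (Dx u) x y + B * Dx (Dy u) x y + C * Dx u x y + D * Dy u x y + E * u x y = 0) :
    A = 0 ∧ B = 0 ∧ C = 0 ∧ D = 0 ∧ E = 0 := by
  have h1 := h (fun _ _ => 1) contDiff_const
  have hx := h (fun s _ => s - x) (contDiff_fst.sub contDiff_const)
  have hy := h (fun _ t => t - y) (contDiff_snd.sub contDiff_const)
  have hxx := h (fun s _ => (s - x) ^ 2) ((contDiff_fst.sub contDiff_const).pow 2)
  have hxy := h (fun s t => (s - x) * (t - y))
    ((contDiff_fst.sub contDiff_const).mul (contDiff_snd.sub contDiff_const))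
  simp [Dx, Dy] at h1 hx hy hxx hxy
  exact ⟨hxx, hxy, hx, hy, h1⟩

theorem stmt11 (r b c r₁ a₁₀ a₀₁ a₀₀ : ℝ → ℝ → ℝ)
    (hr : Smooth2 r) (hb : Smooth2 b) (hc : Smooth2 c) (hr₁ : Smooth2 r₁)
    (ha₁₀ : Smooth2 a₁₀) (ha₀₁ : Smooth2 a₀₁) (ha₀₀ : Smooth2 a₀₀) :
    (∀ u : ℝ → ℝ → ℝ, Smooth2 u → ∀ x y : ℝ,
        r₁ x y * (Dx (Dx u) x y + b x y * Dy u x y + c x y * u x y)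
          + opX r (fun x y => a₁₀ x y * Dx u x y + a₀₁ x y * Dy u x y
              + a₀₀ x y * u x y) x y = 0)
      ↔ ((∀ x y : ℝ, a₀₁ x y = 0) ∧
         (∀ x y : ℝ, r₁ x y = -a₁₀ x y) ∧
         (∀ x y : ℝ, a₁₀ x y * b x y = 0) ∧
         (∀ x y : ℝ, a₀₀ x y = -(r x y * a₁₀ x y) - Dx a₁₀ x y) ∧
         (∀ x y : ℝ, c x y * a₁₀ x y + (r x y) ^ 2 * a₁₀ x y
            + 2 * r x y * Dx a₁₀ x y + a₁₀ x y * Dx r x y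
            + Dx (Dx a₁₀) x y = 0)) := by
  have expand := fun {u} (hu : Smooth2 u) =>
    linearized_factorization_expand r b c r₁ ha₁₀ ha₀₁ ha₀₀ hu
  have hDx (h : ∀ x y, a₀₀ x y = -(r x y * a₁₀ x y) - Dx a₁₀ x y) (x y : ℝ) :
      Dx a₀₀ x y = -(Dx r x y * a₁₀ x y + r x y * Dx a₁₀ x y) - Dx (Dx a₁₀) x y := by
    rw [show a₀₀ = fun x y => -(r x y * a₁₀ x y) - Dx a₁₀ x y from funext₂ h]
    exact (((hr.hasDerivAt_Dx x y).mul (ha₁₀.hasDerivAt_Dx x y)).neg.sub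
      (ha₁₀.dx.hasDerivAt_Dx x y)).deriv
  constructor
  · intro H
    have coeffs := fun x y => coeffs_eq_zero_of_forall_smooth fun u hu =>
      (expand hu x y).symm.trans (H u hu x y)
    have h01 : ∀ x y, a₀₁ x y = 0 := fun x y => (coeffs x y).2.1
    have h₁ : ∀ x y, r₁ x y = -a₁₀ x y := fun x y => by linarith [(coeffs x y).1]
    have h00 : ∀ x y, a₀₀ x y = -(r x y * a₁₀ x y) - Dx a₁₀ x y := fun x y => by
      linarith [(coeffs x y).2.2.1]
    refine ⟨h01, h₁, fun x y => ?_, h00, fun x y => ?_⟩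
    · have h := (coeffs x y).2.2.2.1
      rw [h01, Dx_eq_zero_of_forall h01, h₁] at h
      linear_combination -h
    · have h := (coeffs x y).2.2.2.2
      rw [hDx h00, h00, h₁] at h
      linear_combination -h
  · rintro ⟨h01, h₁, hb0, h00, hc0⟩ u hu x y
    rw [expand hu, hDx h00, Dx_eq_zero_of_forall h01, h01, h00, h₁]
    linear_combination -Dy u x y * hb0 x y - u x y * hc0 x y
end

section
/- Let α, β ∈ ℝ and set w(x,y) = y + αx + β. Then for every smooth u : ℝ² → ℝ and every point with w ≠ 0, applying the operator C : u ↦ ∂ₓ∂_yu − (1/w)·∂ₓu − (α/w)·∂_yu followed by B : v ↦ ∂_yv + (1/w)·v yields B(C(u)) = ∂ₓ∂_y∂_yu − (α/w)·∂_y∂_yu. That is, (D_y + 1/w)∘(D_{xy} − (1/w)Dₓ − (α/w)D_y) = D_{xyy} − (α/w)D_{yy}. -/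
namespace Smooth2

variable {u : ℝ → ℝ → ℝ}

theorem differentiable (hu : Smooth2 u) : Differentiable ℝ (fun p : ℝ × ℝ => u p.1 p.2) :=
  ContDiff.differentiable hu (by simp)

theorem hasDerivAt_Dx_fderiv (hu : Smooth2 u) (x y : ℝ) :
    HasDerivAt (fun s => u s y) (fderiv ℝ (fun p : ℝ × ℝ => u p.1 p.2) (x, y) (1, 0)) x :=
  HasFDerivAt.comp_hasDerivAt (f := fun s => (s, y)) x
    (hu.differentiable (x, y)).hasFDerivAt ((hasDerivAt_id x).prodMk (hasDerivAt_const x y))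

theorem Dx_eq_fderiv (hu : Smooth2 u) (x y : ℝ) :
    Dx u x y = fderiv ℝ (fun p : ℝ × ℝ => u p.1 p.2) (x, y) (1, 0) :=
  (hu.hasDerivAt_Dx_fderiv x y).deriv

theorem hasDerivAt_Dy_fderiv (hu : Smooth2 u) (x y : ℝ) :
    HasDerivAt (fun t => u x t) (fderiv ℝ (fun p : ℝ × ℝ => u p.1 p.2) (x, y) (0, 1)) y :=
  (hu.differentiable (x, y)).hasFDerivAt.comp_hasDerivAt y
    ((hasDerivAt_const y x).prodMk (hasDerivAt_id y))

theorem Dy_eq_fderiv (hu : Smooth2 u) (x y : ℝ) :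
    Dy u x y = fderiv ℝ (fun p : ℝ × ℝ => u p.1 p.2) (x, y) (0, 1) :=
  (hu.hasDerivAt_Dy_fderiv x y).deriv

theorem hasDerivAt_Dy (hu : Smooth2 u) (x y : ℝ) : HasDerivAt (fun t => u x t) (Dy u x y) y :=
  hu.Dy_eq_fderiv x y ▸ hu.hasDerivAt_Dy_fderiv x y

theorem contDiff_fderiv (hu : Smooth2 u) :
    ContDiff ℝ (⊤ : ℕ∞) (fderiv ℝ (fun p : ℝ × ℝ => u p.1 p.2)) :=
  ContDiff.fderiv_right hu (by simp)

protected theorem Dx (hu : Smooth2 u) : Smooth2 (Dx u) := by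
  simp only [Smooth2, hu.Dx_eq_fderiv]
  exact hu.contDiff_fderiv.clm_apply contDiff_const

protected theorem Dy (hu : Smooth2 u) : Smooth2 (Dy u) := by
  simp only [Smooth2, hu.Dy_eq_fderiv]
  exact hu.contDiff_fderiv.clm_apply contDiff_const

theorem Dy_Dx (hu : Smooth2 u) (x y : ℝ) : Dy (Dx u) x y = Dx (Dy u) x y := by
  have hd := hu.contDiff_fderiv.differentiable (by simp) (x, y)
  have hsymm : IsSymmSndFDerivAt ℝ (fun p : ℝ × ℝ => u p.1 p.2) (x, y) :=
    (ContDiff.contDiffAt hu).isSymmSndFDerivAt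
      (by simpa using WithTop.coe_le_coe.2 (le_top : (2 : ℕ∞) ≤ ⊤))
  rw [hu.Dx.Dy_eq_fderiv, hu.Dy.Dx_eq_fderiv]
  simp only [hu.Dx_eq_fderiv, hu.Dy_eq_fderiv, Prod.mk.eta]
  rw [fderiv_clm_apply hd (differentiableAt_const _),
    fderiv_clm_apply hd (differentiableAt_const _)]
  simpa using hsymm (0, 1) (1, 0)

end Smooth2

theorem stmt18 (α β : ℝ) :
    ∀ u : ℝ → ℝ → ℝ, Smooth2 u → ∀ x y : ℝ, y + α * x + β ≠ 0 →
      opY (fun x y => 1 / (y + α * x + β))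
          (fun x y => Dx (Dy u) x y
            - (1 / (y + α * x + β)) * Dx u x y
            - (α / (y + α * x + β)) * Dy u x y) x y
        = Dx (Dy (Dy u)) x y - (α / (y + α * x + β)) * Dy (Dy u) x y := by
  intro u hu x y hw
  have hw' : HasDerivAt (fun t : ℝ => t + α * x + β) 1 y :=
    ((hasDerivAt_id y).add_const (α * x)).add_const β
  have hC := ((hu.Dy.Dx.hasDerivAt_Dy x y).sub
    (((hasDerivAt_const y (1 : ℝ)).div hw' hw).mul (hu.Dx.hasDerivAt_Dy x y))).sub
    (((hasDerivAt_const y α).div hw' hw).mul (hu.Dy.hasDerivAt_Dy x y))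
  have hDy := hC.deriv
  rw [hu.Dy.Dy_Dx, hu.Dy_Dx] at hDy
  refine (congrArg (· + _) hDy).trans ?_
  simp only [Pi.div_apply]
  field_simp
  ring
end
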